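/- arXiv:2003.12626 — 2 statements merged into one kernel-verified Lean document; each statement's English description precedes it below -/
import Mathlib

section
/- Let X : [t₀,T] → ℝ^d be a path, let t₀ < t₁ < … < t_N = T be a grid with step sizes h_k = t_{k+1} − t_k, and let X^h be its piecewise linear interpolation, X^h(t) = X(t_k) + ((t − t_k)/h_k)(X(t_{k+1}) − X(t_k)) for t ∈ (t_k, t_{k+1}]. Then for every labeled rooted tree τ with p vertices carrying labels i₁,…,i_p ∈ {1,…,d}, every k ∈ {0,…,N−1} and every t ∈ (t_k, t_{k+1}], the tree-iterated integral of X^h satisfies ⟨X^h_{t_k,t}, τ⟩ = (1/γ(τ)) · ((t − t_k)/h_k)^p · ∏_{ℓ=1}^{p} (X^{i_ℓ}(t_{k+1}) − X^{i_ℓ}(t_k)). In particular, taking t = t_{k+1}, ⟨X^h_{t_k,t_{k+1}}, τ⟩ = (1/γ(τ)) ∏_{ℓ=1}^{p} (X^{i_ℓ}(t_{k+1}) − X^{i_ℓ}(t_k)). -/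
/-- Labeled rooted trees with vertex labels in `Fin d`: `node i ts` attaches the
trees in `ts` (in any order) to a new root labeled `i`; `•_i = node i []`. -/
inductive LTree (d : ℕ) where
  | node : Fin d → List (LTree d) → LTree d

namespace LTree

/-- `|τ|`, the number of vertices. -/
def size {d : ℕ} : LTree d → ℕ
  | .node _ ts => 1 + (ts.attach.map fun ⟨t, _⟩ => size t).sum

/-- The density `γ`: `γ(•_i) = 1`, `γ([τ₁⋯τ_n]_i) = |[τ₁⋯τ_n]_i|·∏ⱼ γ(τⱼ)`. -/
def gamma {d : ℕ} : LTree d → ℕ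
  | .node i ts => (LTree.node i ts).size * (ts.attach.map fun ⟨t, _⟩ => gamma t).prod

/-- The product `v_{i₁}⋯v_{i_{|τ|}}` of the values of `v` over all vertex labels of `τ`. -/
def labelProd {d : ℕ} (v : Fin d → ℝ) : LTree d → ℝ
  | .node i ts => v i * (ts.attach.map fun ⟨t, _⟩ => labelProd v t).prod

end LTree

/-- Tree-iterated integrals of a path `Y : ℝ → ℝ^d`, defined recursively by
`⟨Y_{s,t}, •_i⟩ = Y^i(t) − Y^i(s)` and
`⟨Y_{s,t}, [τ₁⋯τ_n]_i⟩ = ∫_s^t ⟨Y_{s,u}, τ₁⟩⋯⟨Y_{s,u}, τ_n⟩ (Y^i)'(u) du`. -/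
noncomputable def treeItg {d : ℕ} (Y : ℝ → Fin d → ℝ) : LTree d → ℝ → ℝ → ℝ
  | .node i [], s, t => Y t i - Y s i
  | .node i (τ₀ :: ts), s, t =>
      ∫ u in s..t,
        ((((τ₀ :: ts).attach.map fun ⟨σ, _⟩ => treeItg Y σ s u).prod : ℝ) *
          deriv (fun v => Y v i) u)

theorem LTree.size_node {d : ℕ} (i : Fin d) (ts : List (LTree d)) :
    (LTree.node i ts).size = 1 + (ts.map LTree.size).sum := by
  rw [LTree.size]
  exact congrArg (fun l : List ℕ => 1 + l.sum) (List.attach_map_val (f := LTree.size))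

theorem LTree.gamma_node {d : ℕ} (i : Fin d) (ts : List (LTree d)) :
    (LTree.node i ts).gamma = (LTree.node i ts).size * (ts.map LTree.gamma).prod := by
  rw [LTree.gamma]
  exact congrArg (fun l : List ℕ => (LTree.node i ts).size * l.prod)
    (List.attach_map_val (f := LTree.gamma))

theorem LTree.labelProd_node {d : ℕ} (v : Fin d → ℝ) (i : Fin d) (ts : List (LTree d)) :
    (LTree.node i ts).labelProd v = v i * (ts.map (LTree.labelProd v)).prod := by
  rw [LTree.labelProd]
  exact congrArg (fun l : List ℝ => v i * l.prod)
    (List.attach_map_val (f := LTree.labelProd v))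

theorem treeItg_node_cons {d : ℕ} (Y : ℝ → Fin d → ℝ) (i : Fin d) (τ₀ : LTree d)
    (ts : List (LTree d)) (s t : ℝ) :
    treeItg Y (.node i (τ₀ :: ts)) s t =
      ∫ u in s..t, ((τ₀ :: ts).map (fun σ => treeItg Y σ s u)).prod *
        deriv (fun v => Y v i) u := by
  rw [treeItg]
  refine congrArg (fun f : ℝ → ℝ => ∫ u in s..t, f u) (funext fun u => ?_)
  exact congrArg (fun l : List ℝ => l.prod * deriv (fun v => Y v i) u)
    (List.attach_map_val (f := fun σ => treeItg Y σ s u))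

theorem prod_aux {d : ℕ} (v : Fin d → ℝ) (r : ℝ) (f : LTree d → ℝ) (l : List (LTree d))
    (h : ∀ σ ∈ l, f σ = (1 / (σ.gamma : ℝ)) * r ^ σ.size * σ.labelProd v) :
    (l.map f).prod = (1 / (((l.map LTree.gamma).prod : ℕ) : ℝ)) * r ^ (l.map LTree.size).sum *
      (l.map (LTree.labelProd v)).prod := by
  induction l with
  | nil => simp
  | cons a l ih =>
    rw [List.map_cons, List.prod_cons, h a (by simp), ih fun σ hσ => h σ (by simp [hσ])]
    simp only [List.map_cons, List.prod_cons, List.sum_cons, pow_add, Nat.cast_mul, one_div,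
      mul_inv]
    ring

theorem integral_aux (s e u : ℝ) (n : ℕ) (hse : s < e) :
    ∫ x in s..u, ((x - s) / (e - s)) ^ n * (1 / (e - s)) =
      ((u - s) / (e - s)) ^ (1 + n) / ((1 + n : ℕ) : ℝ) := by
  have hn : ((1 + n : ℕ) : ℝ) ≠ 0 := by positivity
  rw [intervalIntegral.integral_eq_sub_of_hasDerivAt
    (f := fun x => ((x - s) / (e - s)) ^ (1 + n) / ((1 + n : ℕ) : ℝ))]
  · simp
  · intro x _
    have h1 : HasDerivAt (fun x : ℝ => (x - s) / (e - s)) (1 / (e - s)) x :=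
      ((hasDerivAt_id x).sub_const s).div_const _
    have h2 := (h1.pow (1 + n)).div_const ((1 + n : ℕ) : ℝ)
    refine HasDerivAt.congr_deriv h2 ?_
    rw [Nat.add_sub_cancel_left]
    field_simp
  · apply Continuous.intervalIntegrable
    fun_prop

theorem treeItg_linear {d : ℕ} (Y : ℝ → Fin d → ℝ) (a v : Fin d → ℝ) (s e : ℝ) (hse : s < e)
    (hY : ∀ u ∈ Set.Icc s e, ∀ i, Y u i = a i + (u - s) / (e - s) * v i) :
    ∀ (τ : LTree d), ∀ u ∈ Set.Icc s e,
      treeItg Y τ s u = (1 / (τ.gamma : ℝ)) * ((u - s) / (e - s)) ^ τ.size * τ.labelProd v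
  | .node i [], u, hu => by
    rw [treeItg, LTree.gamma_node, LTree.labelProd_node, LTree.size_node, hY u hu,
      hY s ⟨le_rfl, hse.le⟩]
    simp
  | .node i (τ₀ :: ts), u, hu => by
    have ih : ∀ σ ∈ τ₀ :: ts, ∀ u ∈ Set.Icc s e,
        treeItg Y σ s u = (1 / (σ.gamma : ℝ)) * ((u - s) / (e - s)) ^ σ.size * σ.labelProd v :=
      fun σ hmem => treeItg_linear Y a v s e hse hY σ
    rw [treeItg_node_cons, LTree.gamma_node, LTree.labelProd_node, LTree.size_node]
    generalize τ₀ :: ts = l at ih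
    have key : ∫ x in s..u, (l.map (fun σ => treeItg Y σ s x)).prod * deriv (fun w => Y w i) x =
        ∫ x in s..u, ((1 / (((l.map LTree.gamma).prod : ℕ) : ℝ)) *
          (v i * (l.map (LTree.labelProd v)).prod)) *
          (((x - s) / (e - s)) ^ (l.map LTree.size).sum * (1 / (e - s))) := by
      apply intervalIntegral.integral_congr_ae
      have hne : ∀ᵐ x : ℝ, x ≠ u := by
        simp [MeasureTheory.ae_iff]
      filter_upwards [hne] with x hxu hx
      rw [Set.uIoc_of_le hu.1] at hx
      have hx2 : x < e := lt_of_lt_of_le (lt_of_le_of_ne hx.2 hxu) hu.2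
      rw [prod_aux v ((x - s) / (e - s)) _ l fun σ hσ => ih σ hσ x ⟨hx.1.le, hx2.le⟩]
      have h1 : HasDerivAt (fun x : ℝ => a i + (x - s) / (e - s) * v i)
          (1 / (e - s) * v i) x :=
        ((((hasDerivAt_id x).sub_const s).div_const _).mul_const _).const_add _
      have h2 : (fun w => Y w i) =ᶠ[nhds x] fun x : ℝ => a i + (x - s) / (e - s) * v i := by
        filter_upwards [Ioo_mem_nhds hx.1 hx2] with w hw
        exact hY w ⟨hw.1.le, hw.2.le⟩ i
      rw [(h1.congr_of_eventuallyEq h2).deriv]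
      ring
    rw [key, intervalIntegral.integral_const_mul, integral_aux s e u _ hse]
    push_cast
    simp only [one_div, mul_inv, div_eq_mul_inv]
    ring
termination_by τ => sizeOf τ
decreasing_by
  have h : σ ∈ τ₀ :: ts := by assumption
  have := List.sizeOf_lt_of_mem h
  simp only [LTree.node.sizeOf_spec]
  omega

/-- Tree-iterated integrals of the piecewise linear interpolation `X^h` of a path `X` on a
grid `t₀ < t₁ < … < t_N`: for every labeled tree `τ` with `p = |τ|` vertices, every `k` and
every `t ∈ (t_k, t_{k+1}]`,
`⟨X^h_{t_k,t}, τ⟩ = (1/γ(τ)) ((t−t_k)/h_k)^p ∏_ℓ (X^{i_ℓ}(t_{k+1}) − X^{i_ℓ}(t_k))`;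
in particular, for `t = t_{k+1}`,
`⟨X^h_{t_k,t_{k+1}}, τ⟩ = (1/γ(τ)) ∏_ℓ (X^{i_ℓ}(t_{k+1}) − X^{i_ℓ}(t_k))`. -/
theorem treeItg_piecewise_linear
    (d N : ℕ) (t : Fin (N + 1) → ℝ) (ht : StrictMono t)
    (X Xh : ℝ → Fin d → ℝ)
    (hXh₀ : ∀ i, Xh (t 0) i = X (t 0) i)
    (hXh : ∀ k : Fin N, ∀ u ∈ Set.Ioc (t k.castSucc) (t k.succ), ∀ i,
        Xh u i = X (t k.castSucc) i +
          (u - t k.castSucc) / (t k.succ - t k.castSucc) *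
            (X (t k.succ) i - X (t k.castSucc) i)) :
    ∀ (τ : LTree d) (k : Fin N),
      (∀ u ∈ Set.Ioc (t k.castSucc) (t k.succ),
        treeItg Xh τ (t k.castSucc) u =
          (1 / (τ.gamma : ℝ)) *
            ((u - t k.castSucc) / (t k.succ - t k.castSucc)) ^ τ.size *
              τ.labelProd (fun i => X (t k.succ) i - X (t k.castSucc) i)) ∧
      treeItg Xh τ (t k.castSucc) (t k.succ) =
        (1 / (τ.gamma : ℝ)) *
          τ.labelProd (fun i => X (t k.succ) i - X (t k.castSucc) i) := by
  intro τ k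
  have hse : t k.castSucc < t k.succ := ht Fin.castSucc_lt_succ
  have h0 : ∀ i, Xh (t k.castSucc) i = X (t k.castSucc) i := by
    intro i
    obtain ⟨k, hk⟩ := k
    cases k with
    | zero => exact hXh₀ i
    | succ m =>
      have hlt : t (Fin.castSucc ⟨m, by omega⟩ : Fin (N + 1)) < t (Fin.succ ⟨m, by omega⟩) :=
        ht Fin.castSucc_lt_succ
      have h := hXh ⟨m, by omega⟩ _ ⟨hlt, le_rfl⟩ i
      rw [div_self (sub_pos.2 hlt).ne', one_mul, add_sub_cancel] at h
      exact h
  have main := treeItg_linear Xh (X (t k.castSucc))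
    (fun i => X (t k.succ) i - X (t k.castSucc) i) _ _ hse (by
      intro u hu i
      rcases eq_or_lt_of_le hu.1 with h | h
      · rw [← h, h0]; simp
      · exact hXh k u ⟨h, hu.2⟩ i) τ
  refine ⟨fun u hu => main u ⟨hu.1.le, hu.2⟩, ?_⟩
  rw [main _ ⟨hse.le, le_rfl⟩, div_self (sub_pos.2 hse).ne', one_pow, mul_one]
end

section
/- Let t₀ < t₁ < … < t_N = T be a partition with step sizes h_n = t_{n+1} − t_n and mesh h = max_n h_n with h ≤ 1, let α ∈ (1/4, 1] and r₀ > 0. Let y : [t₀, T] → ℝ^m be a path (the exact solution), and let y^h(t; s, ξ) ∈ ℝ^m be a two-parameter flow (the Wong–Zakai approximation) defined for t₀ ≤ s ≤ t ≤ T, satisfying y^h(s; s, ξ) = ξ and y^h(t; s, ξ) = y^h(t; u, y^h(u; s, ξ)) for s ≤ u ≤ t. Let Φ_n : ℝ^m → ℝ^m be one-step maps and y^h_{n+1} = y^h_n + Φ_n(y^h_n) with y^h_0 = y(t₀). Assume: (i) (Wong–Zakai error) there is C₀ > 0 with sup_{t∈[t₀,T]} |y(t) − y^h(t; t₀, y(t₀))|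 ≤ C₀ h^{r₀}; (ii) (local error of the simplified Runge–Kutta step) there is C₁ > 0 with |y^h(t_{n+1}; t_n, ξ) − ξ − Φ_n(ξ)| ≤ C₁ h_n^{4α} for all n < N and ξ ∈ ℝ^m; (iii) (uniform Lipschitz dependence of the flow on the initial value) there is C₂ > 0 with |y^h(t; s, ξ) − y^h(t; s, ξ̃)| ≤ C₂ |ξ − ξ̃| for all t₀ ≤ s ≤ t ≤ T and ξ, ξ̃ ∈ ℝ^m. Then max_{k=0,…,N} |y(t_k) − y^h_k| ≤ (C₀ + C₁ C₂ (T − t₀)) · h^{min{r₀, 4α − 1}}. -/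
/-- Global rate of the simplified Runge–Kutta scheme: if the Wong–Zakai approximation
`y^h(·; t₀, y(t₀))` of the exact solution `y` has error of order `r₀`, the one-step maps
`Φ_n` have local error of order `4α` with respect to the Wong–Zakai flow `y^h`, and `y^h`
depends Lipschitz-continuously on its initial value, then the iterates
`y^h_{n+1} = y^h_n + Φ_n(y^h_n)`, started at `y^h_0 = y(t₀)`, satisfy
`max_k |y(t_k) − y^h_k| ≤ (C₀ + C₁ C₂ (T − t₀)) h^{min{r₀, 4α−1}}` for mesh `h ≤ 1`. -/
theorem global_rate_simplified_RK
    (m N : ℕ) (hN : 1 ≤ N) (t : Fin (N + 1) → ℝ) (ht : StrictMono t)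
    (α : ℝ) (hα : 1 / 4 < α ∧ α ≤ 1) (r₀ : ℝ) (hr₀ : 0 < r₀)
    (y : ℝ → EuclideanSpace ℝ (Fin m))
    (yh : ℝ → ℝ → EuclideanSpace ℝ (Fin m) → EuclideanSpace ℝ (Fin m))
    (hinit : ∀ s, t 0 ≤ s → s ≤ t (Fin.last N) → ∀ ξ, yh s s ξ = ξ)
    (hflow : ∀ s u v, t 0 ≤ s → s ≤ u → u ≤ v → v ≤ t (Fin.last N) →
        ∀ ξ, yh v s ξ = yh v u (yh u s ξ))
    (Φ : Fin N → EuclideanSpace ℝ (Fin m) → EuclideanSpace ℝ (Fin m))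
    (ydh : Fin (N + 1) → EuclideanSpace ℝ (Fin m))
    (hstart : ydh 0 = y (t 0))
    (hstep : ∀ n : Fin N, ydh n.succ = ydh n.castSucc + Φ n (ydh n.castSucc))
    (h : ℝ) (hmesh : ∀ n : Fin N, t n.succ - t n.castSucc ≤ h) (hone : h ≤ 1)
    (C₀ C₁ C₂ : ℝ) (hC₀ : 0 < C₀) (hC₁ : 0 < C₁) (hC₂ : 0 < C₂)
    (hWZ : ∀ v, t 0 ≤ v → v ≤ t (Fin.last N) →
        ‖y v - yh v (t 0) (y (t 0))‖ ≤ C₀ * h ^ r₀)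
    (hloc : ∀ (n : Fin N) (ξ : EuclideanSpace ℝ (Fin m)),
        ‖yh (t n.succ) (t n.castSucc) ξ - ξ - Φ n ξ‖ ≤
          C₁ * (t n.succ - t n.castSucc) ^ (4 * α))
    (hlip : ∀ s v, t 0 ≤ s → s ≤ v → v ≤ t (Fin.last N) →
        ∀ ξ ξ' : EuclideanSpace ℝ (Fin m), ‖yh v s ξ - yh v s ξ'‖ ≤ C₂ * ‖ξ - ξ'‖) :
    ∀ k : Fin (N + 1),
      ‖y (t k) - ydh k‖ ≤
        (C₀ + C₁ * C₂ * (t (Fin.last N) - t 0)) * h ^ min r₀ (4 * α - 1) := by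
  have hlo : ∀ k, t 0 ≤ t k := fun k => ht.monotone (Fin.zero_le k)
  have hhi : ∀ k, t k ≤ t (Fin.last N) := fun k => ht.monotone (Fin.le_last k)
  have hpos : ∀ n : Fin N, 0 < t n.succ - t n.castSucc := fun n =>
    sub_pos.2 (ht Fin.castSucc_lt_succ)
  have h0 : 0 < h := (hpos ⟨0, hN⟩).trans_le (hmesh ⟨0, hN⟩)
  have key : ∀ k : Fin (N + 1), ∀ v, t k ≤ v → v ≤ t (Fin.last N) →
      ‖yh v (t 0) (y (t 0)) - yh v (t k) (ydh k)‖ ≤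
        C₁ * C₂ * (t k - t 0) * h ^ (4 * α - 1) := by
    intro k
    induction k using Fin.induction with
    | zero =>
      intro v _ _
      simp [hstart]
    | succ n ih =>
      intro v hv hvT
      have hle : t n.castSucc ≤ t n.succ := (sub_pos.1 (hpos n)).le
      have h1 := ih v (hle.trans hv) hvT
      have h2 : ‖yh v (t n.castSucc) (ydh n.castSucc) - yh v (t n.succ) (ydh n.succ)‖ ≤
          C₁ * C₂ * (t n.succ - t n.castSucc) * h ^ (4 * α - 1) := by
        rw [hflow (t n.castSucc) (t n.succ) v (hlo _) hle hv hvT]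
        refine (hlip _ _ (hlo _) hv hvT _ _).trans ?_
        have h3 := hloc n (ydh n.castSucc)
        rw [sub_sub, ← hstep n] at h3
        have h4 : (t n.succ - t n.castSucc) ^ (4 * α) ≤
            (t n.succ - t n.castSucc) * h ^ (4 * α - 1) := by
          have h5 : (t n.succ - t n.castSucc) ^ (4 * α) =
              (t n.succ - t n.castSucc) * (t n.succ - t n.castSucc) ^ (4 * α - 1) := by
            rw [← Real.rpow_one_add' (hpos n).le (by linarith [hα.1])]
            congr 1
            ring
          rw [h5]
          exact mul_le_mul_of_nonneg_left
            (Real.rpow_le_rpow (hpos n).le (hmesh n) (by linarith [hα.1])) (hpos n).le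
        calc _ ≤ C₂ * (C₁ * ((t n.succ - t n.castSucc) * h ^ (4 * α - 1))) := by
              gcongr
              exact h3.trans (mul_le_mul_of_nonneg_left h4 hC₁.le)
          _ = _ := by ring
      calc _ ≤ _ := norm_sub_le_norm_sub_add_norm_sub _ (yh v (t n.castSucc) (ydh n.castSucc)) _
        _ ≤ _ := add_le_add h1 h2
        _ = _ := by ring
  intro k
  have h1 := key k (t k) le_rfl (hhi k)
  rw [hinit (t k) (hlo k) (hhi k)] at h1
  have h2 := hWZ (t k) (hlo k) (hhi k)
  have h3 : h ^ r₀ ≤ h ^ min r₀ (4 * α - 1) :=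
    Real.rpow_le_rpow_of_exponent_ge h0 hone (min_le_left _ _)
  have h4 : h ^ (4 * α - 1) ≤ h ^ min r₀ (4 * α - 1) :=
    Real.rpow_le_rpow_of_exponent_ge h0 hone (min_le_right _ _)
  have h5 : 0 ≤ t k - t 0 := sub_nonneg.2 (hlo k)
  have h6 : t k - t 0 ≤ t (Fin.last N) - t 0 := sub_le_sub_right (hhi k) _
  calc _ ≤ _ := norm_sub_le_norm_sub_add_norm_sub _ (yh (t k) (t 0) (y (t 0))) _
    _ ≤ _ := add_le_add h2 h1
    _ ≤ C₀ * h ^ min r₀ (4 * α - 1) +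
        C₁ * C₂ * (t (Fin.last N) - t 0) * h ^ min r₀ (4 * α - 1) := by
      have : 0 ≤ t (Fin.last N) - t 0 := h5.trans h6
      gcongr
    _ = _ := by ring
end
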